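/- There is no sequence β : ℤ → ℂ that is an admissible symbol for (a, b) = (2, 3). (This is the Fourier-multiplier form of the statement that the μDP (generalized Degasperis–Procesi) flow m_t + u m_x + 3 u_x m = 0, with m = −u_xx + ∫u and u a smooth function on the circle, cannot be realized as a metric Euler equation on Diff^∞(S^1) for any regular inertia operator of Fourier type.) -/

import Mathlib

/-- The symbol `λ` of the inertia operator `Λ^a_μ = (−Δ)^{a/2} + μ(·)`:
`λ(0) = 1` and `λ(m) = |m|^a` (real power) for `m ≠ 0`. -/
noncomputable def lamSymbol (a : ℝ) (m : ℤ) : ℝ := if m = 0 then 1 else |(m : ℝ)| ^ a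

/-- `β : ℤ → ℂ` is an admissible symbol for `(a, b)`: `β k ≠ 0` for all `k`, and for all `j, k`,
`λ(j+k)·(β j·(2k+j) + β k·(2j+k)) = β (j+k)·(b·(k·λ(j) + j·λ(k)) + k·λ(k) + j·λ(j))`. -/
def AdmissibleSymbol (a b : ℝ) (β : ℤ → ℂ) : Prop :=
  (∀ k : ℤ, β k ≠ 0) ∧
  (∀ j k : ℤ,
    (lamSymbol a (j + k) : ℂ) *
        (β j * (2 * (k : ℂ) + (j : ℂ)) + β k * (2 * (j : ℂ) + (k : ℂ))) =
      β (j + k) *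
        ((b * ((k : ℝ) * lamSymbol a j + (j : ℝ) * lamSymbol a k) +
            (k : ℝ) * lamSymbol a k + (j : ℝ) * lamSymbol a j : ℝ) : ℂ))

theorem muDP_not_metric : ¬ ∃ β : ℤ → ℂ, AdmissibleSymbol 2 3 β := by
  rintro ⟨β, hne, h⟩
  have lam_zero : lamSymbol 2 0 = 1 := by simp [lamSymbol]
  have lam_one : lamSymbol 2 1 = 1 := by simp [lamSymbol]
  have lam_two : lamSymbol 2 2 = 4 := by norm_num [lamSymbol]
  have h10 := h 1 0
  have h20 := h 2 0
  have h11 := h 1 1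
  norm_num [lam_zero, lam_one, lam_two] at h10 h20 h11
  have hβ : β 0 = 0 := by linear_combination (-3 / 2) * h10 + (1 / 4) * h20 - (3 / 16) * h11
  exact hne 0 hβ
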